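/- There exist an absolute constant C > 0 and an integer k_0 such that for every real δ > 0, every ρ ∈ (0,1), and every integer k ≥ k_0, there exist an integer J ≥ 1 and smooth nonnegative compactly supported functions F_{ℓ,j} : [0,∞) → ℝ (1 ≤ ℓ ≤ k, 1 ≤ j ≤ J), none identically zero, satisfying for each j the support restriction that ∑_{ℓ=1}^k t_ℓ ≤ δ whenever ∏_{ℓ=1}^k F_{ℓ,j}(t_ℓ) ≠ 0, such that the function F(t_1,…,t_k) := ∑_{j=1}^J ∏_{ℓ=1}^k F'_{ℓ,j}(t_ℓ) is symmetric, I_k(F) > 0, and: J_k(F) ≥ (1 - C (log k)^{-1/2}) · (ρ δ log k / k) · I_k(F), and L_k(F) ≤ (1 + C (log k)^{-1/2}) · (ρ δ log k / k)² · I_k(F). -/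

import Mathlib

open MeasureTheory

/-- `F(t₁,…,t_k) = ∑_j ∏_ℓ F'_{ℓ,j}(t_ℓ)`. -/
noncomputable def bigF (k J : ℕ) (Fml : Fin k → Fin J → ℝ → ℝ)
    (t : Fin k → ℝ) : ℝ :=
  ∑ j : Fin J, ∏ ℓ : Fin k, deriv (Fml ℓ j) (t ℓ)

/-- `I_k(F) = ∫_{[0,∞)^k} F(t)² dt`. -/
noncomputable def Iint (k : ℕ) (F : (Fin k → ℝ) → ℝ) : ℝ :=
  ∫ t in {t : Fin k → ℝ | ∀ i, 0 ≤ t i}, (F t) ^ 2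

/-- `J_k(F) = ∫_{[0,∞)^{k-1}} (∫_0^∞ F dt_i)² dt`, written as
`∫_{[0,∞)^k} F(t) · (∫_0^∞ F(t with i-th coordinate u) du) dt`. -/
noncomputable def Jint (k : ℕ) (F : (Fin k → ℝ) → ℝ) (i : Fin k) : ℝ :=
  ∫ t in {t : Fin k → ℝ | ∀ l, 0 ≤ t l},
    F t * ∫ u in Set.Ioi (0:ℝ), F (Function.update t i u)

/-- `L_k(F) = ∫_{[0,∞)^{k-2}} (∫_0^∞ ∫_0^∞ F dt_i dt_j)² dt`, written as
`∫_{[0,∞)^k} F(t) · (∫_0^∞ ∫_0^∞ F(t with coordinates i, j replaced by u, v) du dv) dt`. -/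
noncomputable def Lint (k : ℕ) (F : (Fin k → ℝ) → ℝ) (i j : Fin k) : ℝ :=
  ∫ t in {t : Fin k → ℝ | ∀ l, 0 ≤ t l},
    F t * ∫ u in Set.Ioi (0:ℝ), ∫ v in Set.Ioi (0:ℝ),
      F (Function.update (Function.update t i u) j v)

noncomputable def psiX (h : ℝ) (m : ℕ) (t : ℝ) : ℝ :=
  Real.smoothTransition (t / h - m + 1) - Real.smoothTransition (t / h - m)

lemma psiX_contDiff (h : ℝ) (m : ℕ) : ContDiff ℝ (⊤ : ℕ∞) (psiX h m) := by
  unfold psiX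
  apply ContDiff.sub
  · exact Real.smoothTransition.contDiff.comp (by fun_prop)
  · exact Real.smoothTransition.contDiff.comp (by fun_prop)

lemma psiX_nonneg (h : ℝ) (m : ℕ) (t : ℝ) : 0 ≤ psiX h m t := by
  unfold psiX
  have := Real.smoothTransition.monotone (show t / h - m ≤ t / h - m + 1 by linarith)
  linarith

lemma psiX_zero_right {h : ℝ} (hh : 0 < h) (m : ℕ) {t : ℝ} (ht : (m + 1) * h ≤ t) :
    psiX h m t = 0 := by
  unfold psiX
  have : (m : ℝ) + 1 ≤ t / h := by rwa [le_div_iff₀ hh]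
  rw [Real.smoothTransition.one_of_one_le (by linarith),
    Real.smoothTransition.one_of_one_le (by linarith)]
  simp

lemma psiX_ne_zero {h : ℝ} (hh : 0 < h) (m : ℕ) {t : ℝ} (ht : psiX h m t ≠ 0) :
    (m + 1) * h ≤ t + 2 * h := by
  by_contra hc
  push Not at hc
  apply ht
  have : t / h + 1 < m := by
    have : t / h < m - 1 := by rw [div_lt_iff₀ hh]; linarith
    linarith
  unfold psiX
  rw [Real.smoothTransition.zero_of_nonpos (by linarith),
    Real.smoothTransition.zero_of_nonpos (by linarith)]
  simp

lemma psiX_sum (h : ℝ) (M : ℕ) (t : ℝ) :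
    ∑ m : Fin M, psiX h m t
      = Real.smoothTransition (t / h + 1) - Real.smoothTransition (t / h + 1 - M) := by
  rw [Fin.sum_univ_eq_sum_range (fun m => psiX h m t)]
  induction M with
  | zero => simp
  | succ n ih =>
    rw [Finset.sum_range_succ, ih, psiX]
    push_cast
    rw [show t / h - n + 1 = t / h + 1 - n by ring, show t / h + 1 - (n + 1) = t / h - n by ring]
    ring

noncomputable def GX (g : ℝ → ℝ) (h : ℝ) (m : ℕ) (t : ℝ) : ℝ :=
  Real.smoothTransition (t + 1) * ∫ u in t..((m + 1) * h), psiX h m u * g u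

lemma primX_hasDerivAt {f : ℝ → ℝ} (hf : Continuous f) (R t : ℝ) :
    HasDerivAt (fun t => ∫ u in t..R, f u) (-f t) t :=
  intervalIntegral.integral_hasDerivAt_left (hf.intervalIntegrable _ _)
    (hf.stronglyMeasurableAtFilter _ _) hf.continuousAt

lemma primX_contDiff {f : ℝ → ℝ} (hf : ContDiff ℝ (⊤ : ℕ∞) f) (R : ℝ) :
    ContDiff ℝ (⊤ : ℕ∞) (fun t => ∫ u in t..R, f u) := by
  rw [contDiff_infty_iff_deriv]
  refine ⟨fun t => (primX_hasDerivAt hf.continuous R t).differentiableAt, ?_⟩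
  have : deriv (fun t => ∫ u in t..R, f u) = fun t => - f t :=
    funext fun t => (primX_hasDerivAt hf.continuous R t).deriv
  rw [this]
  exact hf.neg

section GX

lemma GX_contDiff {g : ℝ → ℝ} (hg : ContDiff ℝ (⊤ : ℕ∞) g) (h : ℝ) (m : ℕ) :
    ContDiff ℝ (⊤ : ℕ∞) (GX g h m) := by
  unfold GX
  apply ContDiff.mul
  · exact Real.smoothTransition.contDiff.comp (by fun_prop)
  · exact primX_contDiff ((psiX_contDiff h m).mul hg) _

lemma GX_zero_right {g : ℝ → ℝ} {h : ℝ} (hh : 0 < h) (m : ℕ) {t : ℝ}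
    (ht : (m + 1) * h ≤ t) : GX g h m t = 0 := by
  unfold GX
  rw [intervalIntegral.integral_symm, intervalIntegral.integral_congr (g := fun _ => 0)]
  · simp
  · intro u hu
    rw [Set.uIcc_of_le ht] at hu
    simp [psiX_zero_right hh m hu.1]

lemma GX_compact {g : ℝ → ℝ} {h : ℝ} (hh : 0 < h) (m : ℕ) :
    HasCompactSupport (GX g h m) := by
  refine HasCompactSupport.intro (isCompact_Icc (a := (-1 : ℝ)) (b := (m + 1) * h)) ?_
  intro t ht
  by_cases h1 : t ≤ -1
  · unfold GX
    rw [Real.smoothTransition.zero_of_nonpos (by linarith)]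
    simp
  · apply GX_zero_right hh
    by_contra h2
    exact ht ⟨by linarith, by linarith⟩

lemma GX_nonneg {g : ℝ → ℝ} (hg0 : ∀ t, 0 ≤ t → 0 ≤ g t) {h : ℝ} (hh : 0 < h) (m : ℕ) {t : ℝ}
    (ht : 0 ≤ t) : 0 ≤ GX g h m t := by
  by_cases h1 : (m + 1) * h ≤ t
  · rw [GX_zero_right hh m h1]
  · unfold GX
    apply mul_nonneg (Real.smoothTransition.nonneg _)
    apply intervalIntegral.integral_nonneg (by linarith)
    intro u hu
    exact mul_nonneg (psiX_nonneg _ _ _) (hg0 _ (ht.trans hu.1))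

lemma GX_deriv {g : ℝ → ℝ} (hg : Continuous g) (h : ℝ) (m : ℕ) {t : ℝ} (ht : 0 < t) :
    deriv (GX g h m) t = - (psiX h m t * g t) := by
  have h1 : GX g h m =ᶠ[nhds t] fun t => ∫ u in t..((m + 1) * h), psiX h m u * g u := by
    filter_upwards [lt_mem_nhds ht] with s hs
    unfold GX
    rw [Real.smoothTransition.one_of_one_le (by linarith), one_mul]
  rw [h1.deriv_eq]
  exact (primX_hasDerivAt ((psiX_contDiff h m).continuous.mul hg) _ t).deriv

end GX

open Classical in
lemma lemmaA {g : ℝ → ℝ} (hg : ContDiff ℝ (⊤ : ℕ∞) g) (hg0 : ∀ t, 0 ≤ t → 0 ≤ g t)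
    {θ δ : ℝ} (hδ : θ < δ) (k : ℕ) (hk : 1 ≤ k) :
    ∃ J : ℕ, ∃ Fml : Fin k → Fin J → ℝ → ℝ,
      (∀ ℓ j, ContDiff ℝ (⊤ : ℕ∞) (Fml ℓ j) ∧ HasCompactSupport (Fml ℓ j)) ∧
      (∀ ℓ j t, 0 ≤ t → 0 ≤ Fml ℓ j t) ∧
      (∀ ℓ j, ∃ t, 0 ≤ t ∧ Fml ℓ j t ≠ 0) ∧
      (∀ j : Fin J, ∀ t : Fin k → ℝ, (∀ ℓ, 0 ≤ t ℓ) →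
        (∏ ℓ, Fml ℓ j (t ℓ)) ≠ 0 → ∑ ℓ, t ℓ ≤ δ) ∧
      (∀ (t : Fin k → ℝ) (σ : Equiv.Perm (Fin k)),
        bigF k J Fml (t ∘ σ) = bigF k J Fml t) ∧
      Continuous (bigF k J Fml) ∧
      (∀ t : Fin k → ℝ, (∀ ℓ, 0 < t ℓ) → 0 ≤ (-1) ^ k * bigF k J Fml t) ∧
      (∀ t : Fin k → ℝ, (∀ ℓ, 0 < t ℓ) → (-1) ^ k * bigF k J Fml t ≤ ∏ ℓ, g (t ℓ)) ∧
      (∀ t : Fin k → ℝ, (∀ ℓ, 0 < t ℓ) → ∑ ℓ, t ℓ ≤ θ →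
        (-1) ^ k * bigF k J Fml t = ∏ ℓ, g (t ℓ)) := by
  have hk' : (0 : ℝ) < k := by exact_mod_cast hk
  obtain ⟨h, hh, hkh⟩ : ∃ h : ℝ, 0 < h ∧ θ + k * (2 * h) ≤ δ :=
    ⟨(δ - θ) / (2 * k), by apply div_pos <;> linarith, by field_simp; linarith⟩
  obtain ⟨M, hM⟩ : ∃ M : ℕ, θ / h ≤ M := exists_nat_ge _
  set Q : (Fin k → Fin (M + 1)) → Prop := fun m =>
    (∑ l, ((m l : ℕ) + 1 : ℝ) * h ≤ δ) ∧ ∀ l, ∃ t, 0 ≤ t ∧ GX g h (m l) t ≠ 0 with hQ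
  set Idx : Finset (Fin k → Fin (M + 1)) := Finset.univ.filter Q with hIdx
  have hsumIdx : ∀ f : (Fin k → Fin (M + 1)) → ℝ,
      ∑ j : Fin Idx.card, f (Idx.equivFin.symm j) = ∑ m ∈ Idx, f m := by
    intro f
    rw [Equiv.sum_comp Idx.equivFin.symm (fun m => f m), Finset.sum_coe_sort]
  have hmem : ∀ j : Fin Idx.card, Q (Idx.equivFin.symm j) := by
    intro j
    have := (Idx.equivFin.symm j).2
    exact (Finset.mem_filter.1 this).2
  set Fml : Fin k → Fin Idx.card → ℝ → ℝ := fun l j =>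
    GX g h ((Idx.equivFin.symm j : Fin k → Fin (M + 1)) l) with hFml
  have hbig : ∀ t, bigF k Idx.card Fml t = ∑ m ∈ Idx, ∏ l, deriv (GX g h (m l)) (t l) := by
    intro t
    rw [← hsumIdx]
    rfl
  have hbig2 : ∀ t : Fin k → ℝ, (∀ l, 0 < t l) → (-1) ^ k * bigF k Idx.card Fml t
      = ∑ m ∈ Idx, ∏ l, psiX h (m l) (t l) * g (t l) := by
    intro t ht
    rw [hbig, Finset.mul_sum]
    refine Finset.sum_congr rfl fun m _ => ?_
    rw [Finset.prod_congr rfl fun l _ => GX_deriv hg.continuous h (m l) (ht l), Finset.prod_neg]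
    simp only [Finset.card_univ, Fintype.card_fin]
    rw [← mul_assoc, ← mul_pow]
    simp
  have hterm : ∀ t : Fin k → ℝ, (∀ l, 0 < t l) → ∀ m : Fin k → Fin (M + 1),
      0 ≤ ∏ l, psiX h (m l) (t l) * g (t l) := fun t ht m =>
    Finset.prod_nonneg fun l _ => mul_nonneg (psiX_nonneg _ _ _) (hg0 _ (ht l).le)
  have hfull : ∀ t : Fin k → ℝ, ∑ m : Fin k → Fin (M + 1), ∏ l, psiX h (m l) (t l) * g (t l)
      = ∏ l, ((∑ m : Fin (M + 1), psiX h m (t l)) * g (t l)) := by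
    intro t
    simp_rw [Finset.sum_mul]
    rw [Finset.prod_univ_sum, Fintype.piFinset_univ]
  refine ⟨Idx.card, Fml, fun l j => ⟨GX_contDiff hg _ _, GX_compact hh _⟩,
    fun l j t ht => GX_nonneg hg0 hh _ ht, fun l j => (hmem j).2 l, ?_, ?_, ?_, ?_, ?_, ?_⟩
  · intro j t ht hne
    refine le_trans (Finset.sum_le_sum fun l _ => ?_) (hmem j).1
    rw [Finset.prod_ne_zero_iff] at hne
    by_contra hc
    exact hne l (Finset.mem_univ _) (GX_zero_right hh _ (not_le.1 hc).le)
  · intro t σ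
    rw [hbig, hbig]
    refine Finset.sum_bij' (fun m _ => m ∘ σ.symm) (fun m _ => m ∘ σ) ?_ ?_ ?_ ?_ ?_
    · intro m hm
      simp only [hIdx, Finset.mem_filter, Finset.mem_univ, true_and, hQ] at hm ⊢
      refine ⟨?_, fun l => hm.2 _⟩
      have := Equiv.sum_comp σ.symm (fun l => ((m l : ℕ) + 1 : ℝ) * h)
      simp only [Function.comp]
      rw [this]; exact hm.1
    · intro m hm
      simp only [hIdx, Finset.mem_filter, Finset.mem_univ, true_and, hQ] at hm ⊢
      refine ⟨?_, fun l => hm.2 _⟩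
      have := Equiv.sum_comp σ (fun l => ((m l : ℕ) + 1 : ℝ) * h)
      simp only [Function.comp]
      rw [this]; exact hm.1
    · intro m _; ext l; simp
    · intro m _; ext l; simp
    · intro m _
      rw [← Equiv.prod_comp σ (fun l => deriv (GX g h ((m ∘ σ.symm) l)) (t l))]
      simp
  · unfold bigF
    refine continuous_finsetSum _ fun j _ => continuous_finsetProd _ fun l _ => ?_
    exact ((GX_contDiff hg h _).continuous_deriv (by simp)).comp (continuous_apply l)
  · intro t ht
    rw [hbig2 t ht]
    exact Finset.sum_nonneg fun m _ => hterm t ht m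
  · intro t ht
    rw [hbig2 t ht]
    calc _ ≤ ∑ m : Fin k → Fin (M + 1), ∏ l, psiX h (m l) (t l) * g (t l) :=
          Finset.sum_le_sum_of_subset_of_nonneg (Finset.subset_univ _) fun m _ _ => hterm t ht m
      _ = _ := hfull t
      _ ≤ _ := by
          refine Finset.prod_le_prod (fun l _ => ?_) (fun l _ => ?_)
          · exact mul_nonneg (Finset.sum_nonneg fun m _ => psiX_nonneg _ _ _) (hg0 _ (ht l).le)
          · refine mul_le_of_le_one_left (hg0 _ (ht l).le) ?_
            rw [psiX_sum]
            linarith [Real.smoothTransition.le_one (t l / h + 1),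
              Real.smoothTransition.nonneg (t l / h + 1 - (M + 1 : ℕ))]
  · intro t ht hs
    rw [hbig2 t ht]
    have e1 : ∑ m ∈ Idx, ∏ l, psiX h (m l) (t l) * g (t l)
        = ∑ m : Fin k → Fin (M + 1), ∏ l, psiX h (m l) (t l) * g (t l) := by
      refine Finset.sum_subset (Finset.subset_univ _) fun m _ hm => ?_
      by_contra hne
      rw [← ne_eq, Finset.prod_ne_zero_iff] at hne
      apply hm
      simp only [hIdx, Finset.mem_filter, Finset.mem_univ, true_and, hQ]
      constructor
      · calc ∑ l, ((m l : ℕ) + 1 : ℝ) * h ≤ ∑ l, (t l + 2 * h) :=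
              Finset.sum_le_sum fun l _ => psiX_ne_zero hh _ (left_ne_zero_of_mul (hne l (Finset.mem_univ _)))
          _ = (∑ l, t l) + k * (2 * h) := by
              rw [Finset.sum_add_distrib]; simp
          _ ≤ δ := by linarith
      · intro l
        by_contra hc
        push Not at hc
        have hd := GX_deriv hg.continuous h (m l) (ht l)
        have : GX g h (m l) =ᶠ[nhds (t l)] fun _ => 0 := by
          filter_upwards [lt_mem_nhds (ht l)] with s hs
          exact hc s hs.le
        rw [this.deriv_eq] at hd
        simp only [deriv_const] at hd
        exact hne l (Finset.mem_univ _) (by linarith)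
    rw [e1, hfull]
    refine Finset.prod_congr rfl fun l _ => ?_
    have htl : t l ≤ θ :=
      (Finset.single_le_sum (f := t) (fun i _ => (ht i).le) (Finset.mem_univ l)).trans hs
    have h2 : t l / h ≤ M := le_trans (div_le_div_of_nonneg_right htl hh.le) hM
    have h3 : 0 < t l / h := div_pos (ht l) hh
    rw [psiX_sum, Real.smoothTransition.one_of_one_le (by linarith),
      Real.smoothTransition.zero_of_nonpos (by push_cast; linarith)]
    ring

/-- Lebesgue measure on the positive half-line. -/
noncomputable def nuX : Measure ℝ := volume.restrict (Set.Ioi 0)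

instance : SigmaFinite nuX := by unfold nuX; infer_instance

noncomputable def muX (k : ℕ) : Measure (Fin k → ℝ) := Measure.pi fun _ => nuX

instance (k : ℕ) : SigmaFinite (muX k) := by unfold muX; infer_instance

lemma muX_eq (k : ℕ) : volume.restrict {t : Fin k → ℝ | ∀ i, 0 ≤ t i} = muX k := by
  have : {t : Fin k → ℝ | ∀ i, 0 ≤ t i} = Set.univ.pi fun _ => Set.Ici 0 := by
    ext t
    simp only [Set.mem_ofPred_eq, Set.mem_pi, Set.mem_univ, true_implies, Set.mem_Ici]
  rw [this, volume_pi, Measure.restrict_pi_pi]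
  unfold muX nuX
  congr 1
  funext i
  exact restrict_Ioi_eq_restrict_Ici.symm

lemma nuX_ae : ∀ᵐ t ∂nuX, 0 < t := by
  unfold nuX
  exact ae_restrict_mem measurableSet_Ioi

lemma muX_ae (k : ℕ) : ∀ᵐ t ∂muX k, ∀ i, 0 < t i := by
  unfold muX
  rw [ae_all_iff]
  intro i
  exact (Measure.quasiMeasurePreserving_eval (μ := fun _ : Fin k => nuX) i).ae nuX_ae

lemma secondMoment {k : ℕ} (w φ : Fin k → ℝ → ℝ) (h0 : ∀ l, Integrable (w l) nuX)
    (h1 : ∀ l, Integrable (fun t => w l t * φ l t) nuX)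
    (h2 : ∀ l, Integrable (fun t => w l t * φ l t ^ 2) nuX)
    (hz : ∀ l, ∫ t, w l t * φ l t ∂nuX = 0) :
    Integrable (fun t : Fin k → ℝ => (∏ l, w l (t l)) * (∑ l, φ l (t l)) ^ 2) (muX k) ∧
    ∫ t, (∏ l, w l (t l)) * (∑ l, φ l (t l)) ^ 2 ∂muX k
      = ∑ l, (∫ t, w l t * φ l t ^ 2 ∂nuX) * ∏ l' ∈ Finset.univ.erase l, ∫ t, w l' t ∂nuX := by
  set W : Fin k → Fin k → Fin k → ℝ → ℝ := fun i j l t =>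
    w l t * ((if l = i then φ l t else 1) * (if l = j then φ l t else 1)) with hW
  have hWint : ∀ i j l, Integrable (W i j l) nuX := by
    intro i j l
    simp only [hW]
    by_cases hi : l = i <;> by_cases hj : l = j
    · simp only [hi, if_true, ← pow_two, ← hi.symm.trans hj]; exact h2 i
    · simp only [hi, if_true, if_neg (hi ▸ hj), mul_one]; exact h1 i
    · simp only [if_neg hi, hj, if_true, one_mul]
      simp only [if_neg (hj ▸ hi), one_mul]; exact h1 j
    · simp only [if_neg hi, if_neg hj, mul_one]; exact h0 l
  have hexp : (fun t : Fin k → ℝ => (∏ l, w l (t l)) * (∑ l, φ l (t l)) ^ 2)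
      = fun t => ∑ i, ∑ j, ∏ l, W i j l (t l) := by
    funext t
    rw [pow_two, Finset.sum_mul_sum, Finset.mul_sum]
    refine Finset.sum_congr rfl fun i _ => ?_
    rw [Finset.mul_sum]
    refine Finset.sum_congr rfl fun j _ => ?_
    simp only [hW, Finset.prod_mul_distrib]
    congr 1
    simp
  have hint : ∀ i j, Integrable (fun t : Fin k → ℝ => ∏ l, W i j l (t l)) (muX k) := fun i j =>
    Integrable.fintype_prod (f := W i j) (hWint i j)
  rw [hexp]
  refine ⟨integrable_finsetSum _ fun i _ => integrable_finsetSum _ fun j _ => hint i j, ?_⟩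
  rw [integral_finsetSum _ fun i _ => integrable_finsetSum _ fun j _ => hint i j]
  refine Finset.sum_congr rfl fun i _ => ?_
  rw [integral_finsetSum _ fun j _ => hint i j]
  have hval : ∀ j, ∫ t, ∏ l, W i j l (t l) ∂muX k = ∏ l, ∫ t, W i j l t ∂nuX := fun j =>
    integral_fintype_prod_eq_prod (W i j)
  rw [Finset.sum_eq_single i]
  · rw [hval, ← Finset.mul_prod_erase _ _ (Finset.mem_univ i)]
    congr 1
    · simp [hW, pow_two]
    · refine Finset.prod_congr rfl fun l hl => ?_
      simp [hW, Finset.ne_of_mem_erase hl]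
  · intro j _ hj
    rw [hval]
    refine Finset.prod_eq_zero (Finset.mem_univ i) ?_
    simp only [hW, if_true, if_neg hj.symm, mul_one]
    exact hz i
  · simp

/-- Data for the weight function. -/
structure WX (g : ℝ → ℝ) (T : ℝ) : Prop where
  cont : Continuous g
  nonneg : ∀ t, 0 ≤ t → 0 ≤ g t
  supp : ∀ t, T ≤ t → g t = 0

lemma WX.integrable_of {g : ℝ → ℝ} {T : ℝ} (hg : WX g T) {f : ℝ → ℝ} (hf : Continuous f) :
    Integrable (fun t => g t * f t) nuX := by
  have hi : IntegrableOn (fun t => g t * f t) (Set.Ioc 0 T) volume :=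
    ((hg.cont.mul hf).integrableOn_Icc (a := 0) (b := T)).mono_set Set.Ioc_subset_Icc_self
  unfold nuX
  change IntegrableOn _ _ _
  refine IntegrableOn.of_forall_sdiff_eq_zero hi measurableSet_Ioi ?_
  intro t ht
  have : T ≤ t := by
    by_contra hc
    exact ht.2 ⟨ht.1, by linarith⟩
  simp [hg.supp t this]

section main
variable {g : ℝ → ℝ} {T : ℝ} {k : ℕ} {P : (Fin k → ℝ) → ℝ} {θ m : ℝ}

lemma WX.int_g (hg : WX g T) : Integrable g nuX := by
  simpa using hg.integrable_of (f := fun _ => 1) (by fun_prop)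

lemma WX.int_g2 (hg : WX g T) : Integrable (fun t => g t ^ 2) nuX := by
  simpa [pow_two] using hg.integrable_of (f := g) hg.cont

lemma WX.int_g2f (hg : WX g T) {f : ℝ → ℝ} (hf : Continuous f) :
    Integrable (fun t => g t ^ 2 * f t) nuX := by
  have := hg.integrable_of (f := fun t => g t * f t) (hg.cont.mul hf)
  refine this.congr (Filter.Eventually.of_forall fun t => ?_)
  simp only; ring

/-- pointwise hypotheses on `P` -/
structure PX (g : ℝ → ℝ) (θ : ℝ) (P : (Fin k → ℝ) → ℝ) : Prop where
  cont : Continuous P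
  nonneg : ∀ t : Fin k → ℝ, (∀ l, 0 < t l) → 0 ≤ P t
  le : ∀ t : Fin k → ℝ, (∀ l, 0 < t l) → P t ≤ ∏ l, g (t l)
  eq : ∀ t : Fin k → ℝ, (∀ l, 0 < t l) → ∑ l, t l ≤ θ → P t = ∏ l, g (t l)

lemma I_upper (hg : WX g T) (hP : PX g θ P) :
    Iint k P ≤ (∫ t, g t ^ 2 ∂nuX) ^ k := by
  unfold Iint
  rw [muX_eq]
  have h1 : ∫ t, ∏ l, g (t l) ^ 2 ∂muX k = (∫ t, g t ^ 2 ∂nuX) ^ k := by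
    have := integral_fintype_prod_eq_prod (μ := fun _ : Fin k => nuX)
      (fun (_ : Fin k) t => g t ^ 2)
    unfold muX
    simpa using this
  rw [← h1]
  refine integral_mono_of_nonneg (Filter.Eventually.of_forall fun t => sq_nonneg _)
    (Integrable.fintype_prod (f := fun _ t => g t ^ 2) fun _ => hg.int_g2) ?_
  filter_upwards [muX_ae k] with t ht
  rw [Finset.prod_pow]
  exact pow_le_pow_left₀ (hP.nonneg t ht) (hP.le t ht) 2

lemma I_integrable (hg : WX g T) (hP : PX g θ P) : Integrable (fun t => P t ^ 2) (muX k) := by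
  refine Integrable.mono' (Integrable.fintype_prod (f := fun _ t => g t ^ 2)
    fun _ : Fin k => hg.int_g2) (hP.cont.pow 2).aestronglyMeasurable ?_
  change ∀ᵐ t ∂muX k, _
  filter_upwards [muX_ae k] with t ht
  rw [Finset.prod_pow, Real.norm_of_nonneg (sq_nonneg _)]
  exact pow_le_pow_left₀ (hP.nonneg t ht) (hP.le t ht) 2

lemma I_lower (hg : WX g T) (hP : PX g θ P) {b v η : ℝ} (hb : ∫ t, g t ^ 2 ∂nuX = b)
    (hm : ∫ t, g t ^ 2 * (t - m) ∂nuX = 0) (hv : ∫ t, g t ^ 2 * (t - m) ^ 2 ∂nuX = v)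
    (hη : 0 < η) (hη2 : η ≤ θ - k * m) :
    b ^ k - k * (v * b ^ (k - 1)) / η ^ 2 ≤ Iint k P := by
  unfold Iint
  rw [muX_eq]
  obtain ⟨s1, s2⟩ := secondMoment (fun (_ : Fin k) t => g t ^ 2) (fun _ t => t - m)
    (fun _ => hg.int_g2) (fun _ => hg.int_g2f (by fun_prop))
    (fun _ => hg.int_g2f (by fun_prop)) (fun _ => hm)
  have h1 : ∫ t, ∏ l, g (t l) ^ 2 ∂muX k = b ^ k := by
    have := integral_fintype_prod_eq_prod (μ := fun _ : Fin k => nuX)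
      (fun (_ : Fin k) t => g t ^ 2)
    unfold muX
    simpa [hb] using this
  have i1 : Integrable (fun t : Fin k → ℝ => ∏ l, g (t l) ^ 2) (muX k) :=
    Integrable.fintype_prod (f := fun _ t => g t ^ 2) fun _ => hg.int_g2
  simp only [hb, hv, Finset.prod_const, Finset.card_erase_of_mem (Finset.mem_univ _),
    Finset.card_univ, Fintype.card_fin, Finset.sum_const, nsmul_eq_mul] at s2
  rw [← s2, ← h1, ← integral_div, ← integral_sub i1 (s1.div_const _)]
  refine integral_mono_ae (i1.sub (s1.div_const _)) (I_integrable hg hP) ?_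
  filter_upwards [muX_ae k] with t ht
  by_cases hs : ∑ l, t l ≤ θ
  · rw [hP.eq t ht hs, Finset.prod_pow]
    have : 0 ≤ (∏ l, g (t l)) ^ 2 * (∑ l, (t l - m)) ^ 2 / η ^ 2 := by positivity
    linarith
  · push Not at hs
    have h3 : η ^ 2 ≤ (∑ l, (t l - m)) ^ 2 := by
      apply pow_le_pow_left₀ hη.le
      rw [Finset.sum_sub_distrib]
      simp
      linarith
    have h4 : ∏ l, g (t l) ^ 2 ≤ (∏ l, g (t l) ^ 2) * (∑ l, (t l - m)) ^ 2 / η ^ 2 := by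
      rw [le_div_iff₀ (by positivity)]
      exact mul_le_mul_of_nonneg_left h3 (Finset.prod_nonneg fun _ _ => sq_nonneg _)
    have := sq_nonneg (P t)
    linarith

lemma prod_updX (g : ℝ → ℝ) (t : Fin k → ℝ) (i : Fin k) (u : ℝ) :
    ∏ l, g (Function.update t i u l) = g u * ∏ l ∈ Finset.univ.erase i, g (t l) := by
  rw [← Finset.mul_prod_erase _ _ (Finset.mem_univ i), Function.update_self]
  congr 1
  refine Finset.prod_congr rfl fun l hl => ?_
  rw [Function.update_of_ne (Finset.ne_of_mem_erase hl)]

lemma upd_posX {t : Fin k → ℝ} (ht : ∀ l, 0 < t l) (i : Fin k) {u : ℝ} (hu : 0 < u) :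
    ∀ l, 0 < Function.update t i u l := by
  intro l
  by_cases h : l = i
  · subst h; simpa
  · rw [Function.update_of_ne h]; exact ht l

lemma inner_nonneg (hP : PX g θ P) {t : Fin k → ℝ} (ht : ∀ l, 0 < t l) (i : Fin k) :
    0 ≤ ∫ u, P (Function.update t i u) ∂nuX := by
  refine integral_nonneg_of_ae ?_
  filter_upwards [nuX_ae] with u hu
  exact hP.nonneg _ (upd_posX ht i hu)

lemma inner_le (hg : WX g T) (hP : PX g θ P) {t : Fin k → ℝ} (ht : ∀ l, 0 < t l) (i : Fin k) :
    ∫ u, P (Function.update t i u) ∂nuX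
      ≤ (∫ u, g u ∂nuX) * ∏ l ∈ Finset.univ.erase i, g (t l) := by
  rw [← integral_mul_const]
  refine integral_mono_of_nonneg ?_ (hg.int_g.mul_const _) ?_
  · filter_upwards [nuX_ae] with u hu
    exact hP.nonneg _ (upd_posX ht i hu)
  · filter_upwards [nuX_ae] with u hu
    rw [← prod_updX]
    exact hP.le _ (upd_posX ht i hu)

lemma inner_eq (hg : WX g T) (hP : PX g θ P) {t : Fin k → ℝ} (ht : ∀ l, 0 < t l) (i : Fin k)
    (hs : ∑ l ∈ Finset.univ.erase i, t l ≤ θ - T) :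
    ∫ u, P (Function.update t i u) ∂nuX
      = (∫ u, g u ∂nuX) * ∏ l ∈ Finset.univ.erase i, g (t l) := by
  rw [← integral_mul_const]
  refine integral_congr_ae ?_
  filter_upwards [nuX_ae] with u hu
  rw [← prod_updX]
  have hpos := upd_posX ht i hu
  by_cases hu2 : T ≤ u
  · apply le_antisymm (hP.le _ hpos)
    rw [prod_updX, hg.supp u hu2, zero_mul]
    exact hP.nonneg _ hpos
  · apply hP.eq _ hpos
    rw [← Finset.add_sum_erase _ _ (Finset.mem_univ i), Function.update_self]
    rw [Finset.sum_congr rfl fun l hl => Function.update_of_ne (Finset.ne_of_mem_erase hl) u t]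
    linarith

lemma J_integrable (hg : WX g T) (hP : PX g θ P) (i : Fin k) {a : ℝ}
    (ha : ∫ t, g t ∂nuX = a) :
    Integrable (fun t => P t * ∫ u, P (Function.update t i u) ∂nuX) (muX k) := by
  have i1 : Integrable (fun t : Fin k → ℝ => ∏ l, (fun l t => if l = i then a * g t else g t ^ 2)
      l (t l)) (muX k) := by
    refine Integrable.fintype_prod (μ := fun _ => nuX)
      (f := fun l t => if l = i then a * g t else g t ^ 2) fun l => ?_
    by_cases h : l = i
    · simpa [h] using hg.int_g.const_mul a
    · simpa [h] using hg.int_g2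
  refine i1.mono' ?_ ?_
  · refine hP.cont.aestronglyMeasurable.mul ?_
    have hc : Continuous (fun p : (Fin k → ℝ) × ℝ => P (Function.update p.1 i p.2)) :=
      hP.cont.comp (continuous_fst.update i continuous_snd)
    exact (hc.stronglyMeasurable.integral_prod_right' (ν := nuX)).aestronglyMeasurable
  · filter_upwards [muX_ae k] with t ht
    rw [Real.norm_of_nonneg (mul_nonneg (hP.nonneg t ht) (inner_nonneg hP ht i))]
    refine (mul_le_mul (hP.le t ht) (inner_le hg hP ht i) (inner_nonneg hP ht i)
      (Finset.prod_nonneg fun l _ => hg.nonneg _ (ht l).le)).trans (le_of_eq ?_)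
    rw [← Finset.mul_prod_erase _ _ (Finset.mem_univ i),
      ← Finset.mul_prod_erase _ _ (Finset.mem_univ i), ha]
    simp only [if_true]
    rw [Finset.prod_congr rfl (fun l hl => if_neg (Finset.ne_of_mem_erase hl)), Finset.prod_pow]
    ring

lemma J_lower (hg : WX g T) (hP : PX g θ P) {a b v η : ℝ} (i : Fin k)
    (ha : ∫ t, g t ∂nuX = a) (hb : ∫ t, g t ^ 2 ∂nuX = b)
    (hm : ∫ t, g t ^ 2 * (t - m) ∂nuX = 0) (hv : ∫ t, g t ^ 2 * (t - m) ^ 2 ∂nuX = v)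
    (hη : 0 < η) (hη2 : η ≤ θ - T - (k - 1) * m) :
    a ^ 2 * b ^ (k - 1) - (k - 1) * (v * (a ^ 2 * b ^ (k - 2))) / η ^ 2 ≤ Jint k P i := by
  have hk1 : 1 ≤ k := by have := i.2; omega
  unfold Jint
  rw [muX_eq]
  change _ ≤ ∫ t, P t * ∫ u, P (Function.update t i u) ∂nuX ∂muX k
  set w : Fin k → ℝ → ℝ := fun l t => if l = i then a * g t else g t ^ 2 with hw
  set φ : Fin k → ℝ → ℝ := fun l t => if l = i then 0 else t - m with hφ
  have wi : ∀ l, Integrable (w l) nuX := by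
    intro l
    by_cases h : l = i
    · simpa [hw, h] using hg.int_g.const_mul a
    · simpa [hw, h] using hg.int_g2
  have hwi : ∫ t, w i t ∂nuX = a ^ 2 := by
    simp only [hw, if_true, integral_const_mul, ha]; ring
  have hwl : ∀ l, l ≠ i → ∫ t, w l t ∂nuX = b := by
    intro l h
    simp only [hw, if_neg h, hb]
  obtain ⟨s1, s2⟩ := secondMoment w φ wi
    (by
      intro l
      by_cases h : l = i
      · simp [hφ, h]
      · simpa [hw, hφ, h] using hg.int_g2f (f := fun t => t - m) (by fun_prop))
    (by
      intro l
      by_cases h : l = i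
      · simp [hφ, h]
      · simpa [hw, hφ, h] using hg.int_g2f (f := fun t => (t - m) ^ 2) (by fun_prop))
    (by
      intro l
      by_cases h : l = i
      · simp [hφ, h]
      · simpa [hw, hφ, h] using hm)
  have i1 : Integrable (fun t : Fin k → ℝ => ∏ l, w l (t l)) (muX k) :=
    Integrable.fintype_prod wi
  have h1 : ∫ t, ∏ l, w l (t l) ∂muX k = a ^ 2 * b ^ (k - 1) := by
    have := integral_fintype_prod_eq_prod (μ := fun _ : Fin k => nuX) w
    unfold muX
    rw [this, ← Finset.mul_prod_erase _ _ (Finset.mem_univ i), hwi,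
      Finset.prod_congr rfl fun l hl => hwl l (Finset.ne_of_mem_erase hl)]
    simp
  have h2 : ∑ l, (∫ t, w l t * φ l t ^ 2 ∂nuX) * ∏ l' ∈ Finset.univ.erase l, ∫ t, w l' t ∂nuX
      = (k - 1) * (v * (a ^ 2 * b ^ (k - 2))) := by
    rw [← Finset.add_sum_erase _ _ (Finset.mem_univ i)]
    rw [Finset.sum_congr rfl (g := fun _ => v * (a ^ 2 * b ^ (k - 2)))]
    · simp [hφ, Nat.cast_sub hk1]
    · intro l hl
      have hli := Finset.ne_of_mem_erase hl
      congr 1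
      · simp only [hw, hφ, if_neg hli, hv]
      · have hmem : i ∈ Finset.univ.erase l := by simp [hli.symm]
        rw [← Finset.mul_prod_erase _ _ hmem, hwi,
          Finset.prod_congr rfl fun l hl => hwl l (Finset.ne_of_mem_erase hl)]
        rw [Finset.prod_const, Finset.card_erase_of_mem hmem,
          Finset.card_erase_of_mem (Finset.mem_univ _)]
        simp [Nat.sub_sub]
  rw [h2] at s2
  rw [← s2, ← h1, ← integral_div, ← integral_sub i1 (s1.div_const _)]
  refine integral_mono_ae (i1.sub (s1.div_const _)) (J_integrable hg hP i ha) ?_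
  filter_upwards [muX_ae k] with t ht
  have ha0 : 0 ≤ a := by
    rw [← ha]
    refine integral_nonneg_of_ae ?_
    filter_upwards [nuX_ae] with u hu
    exact hg.nonneg u hu.le
  have hprod : ∏ l, w l (t l) = a * g (t i) * (∏ l ∈ Finset.univ.erase i, g (t l)) ^ 2 := by
    rw [← Finset.mul_prod_erase _ _ (Finset.mem_univ i), ← Finset.prod_pow]
    congr 1
    · simp [hw]
    · refine Finset.prod_congr rfl fun l hl => ?_
      simp [hw, Finset.ne_of_mem_erase hl]
  have hsum : ∑ l, φ l (t l) = (∑ l ∈ Finset.univ.erase i, t l) - (k - 1) * m := by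
    rw [← Finset.add_sum_erase _ _ (Finset.mem_univ i),
      Finset.sum_congr rfl (g := fun l => t l - m)]
    · simp [hφ, Nat.cast_sub hk1]
    · intro l hl
      simp [hφ, Finset.ne_of_mem_erase hl]
  have hw0 : 0 ≤ ∏ l, w l (t l) := by
    rw [hprod]
    exact mul_nonneg (mul_nonneg ha0 (hg.nonneg _ (ht i).le)) (sq_nonneg _)
  have hR : 0 ≤ P t * ∫ u, P (Function.update t i u) ∂nuX :=
    mul_nonneg (hP.nonneg t ht) (inner_nonneg hP ht i)
  by_cases hti : T ≤ t i
  · have : ∏ l, w l (t l) = 0 := by rw [hprod, hg.supp _ hti]; ring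
    simp only [this]
    simpa using hR
  by_cases hs : ∑ l ∈ Finset.univ.erase i, t l ≤ θ - T
  · rw [inner_eq hg hP ht i hs, hP.eq t ht,
      ← Finset.mul_prod_erase _ (fun l => g (t l)) (Finset.mem_univ i), ha]
    · have : 0 ≤ (∏ l, w l (t l)) * (∑ l, φ l (t l)) ^ 2 / η ^ 2 := by positivity
      have e : ∏ l, w l (t l) = g (t i) * (∏ l ∈ Finset.univ.erase i, g (t l)) *
        (a * ∏ l ∈ Finset.univ.erase i, g (t l)) := by rw [hprod]; ring
      linarith
    · rw [← Finset.add_sum_erase _ _ (Finset.mem_univ i)]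
      linarith
  · push Not at hs
    have h3 : η ^ 2 ≤ (∑ l, φ l (t l)) ^ 2 := by
      apply pow_le_pow_left₀ hη.le
      rw [hsum]
      linarith
    have h4 : ∏ l, w l (t l) ≤ (∏ l, w l (t l)) * (∑ l, φ l (t l)) ^ 2 / η ^ 2 := by
      rw [le_div_iff₀ (by positivity)]
      exact mul_le_mul_of_nonneg_left h3 hw0
    linarith

lemma L_upper (hg : WX g T) (hP : PX g θ P) {a b : ℝ} (i j : Fin k) (hij : i ≠ j)
    (ha : ∫ t, g t ∂nuX = a) (hb : ∫ t, g t ^ 2 ∂nuX = b) :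
    Lint k P i j ≤ a ^ 4 * b ^ (k - 2) := by
  unfold Lint
  rw [muX_eq]
  change ∫ t, P t * ∫ u, ∫ v, P (Function.update (Function.update t i u) j v) ∂nuX ∂nuX ∂muX k ≤ _
  set w : Fin k → ℝ → ℝ := fun l t => if l = i ∨ l = j then a * g t else g t ^ 2 with hw
  have wi : ∀ l, Integrable (w l) nuX := by
    intro l
    by_cases h : l = i ∨ l = j
    · simpa [hw, h] using hg.int_g.const_mul a
    · simpa [hw, h] using hg.int_g2
  have hmem : j ∈ Finset.univ.erase i := by simp [hij.symm]
  have hmem2 : i ∈ Finset.univ.erase j := by simp [hij]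
  have hnot : ∀ l ∈ (Finset.univ.erase i).erase j, ¬ (l = i ∨ l = j) := by
    intro l hl
    simp at hl
    tauto
  have h1 : ∫ t, ∏ l, w l (t l) ∂muX k = a ^ 4 * b ^ (k - 2) := by
    have := integral_fintype_prod_eq_prod (μ := fun _ : Fin k => nuX) w
    unfold muX
    rw [this, ← Finset.mul_prod_erase _ _ (Finset.mem_univ i), ← Finset.mul_prod_erase _ _ hmem,
      Finset.prod_congr rfl (g := fun _ => b)]
    · rw [Finset.prod_const, Finset.card_erase_of_mem hmem,
          Finset.card_erase_of_mem (Finset.mem_univ _)]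
      simp only [hw, true_or, or_true, if_true, integral_const_mul, ha]
      simp [Nat.sub_sub]
      ring
    · intro l hl
      simp only [hw, if_neg (hnot l hl), hb]
  rw [← h1]
  have hdbl : ∀ t : Fin k → ℝ, (∀ l, 0 < t l) →
      0 ≤ ∫ u, ∫ v, P (Function.update (Function.update t i u) j v) ∂nuX ∂nuX ∧
      ∫ u, ∫ v, P (Function.update (Function.update t i u) j v) ∂nuX ∂nuX
        ≤ a * (a * ∏ l ∈ (Finset.univ.erase i).erase j, g (t l)) := by
    intro t ht
    constructor
    · refine integral_nonneg_of_ae ?_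
      filter_upwards [nuX_ae] with u hu
      exact inner_nonneg hP (upd_posX ht i hu) j
    · conv_rhs => rw [← ha, ← integral_mul_const]
      refine integral_mono_of_nonneg ?_ (hg.int_g.mul_const _) ?_
      · filter_upwards [nuX_ae] with u hu
        exact inner_nonneg hP (upd_posX ht i hu) j
      · filter_upwards [nuX_ae] with u hu
        refine (inner_le hg hP (upd_posX ht i hu) j).trans (le_of_eq ?_)
        rw [← Finset.mul_prod_erase _ _ hmem2, Function.update_self, Finset.erase_right_comm,
          Finset.prod_congr rfl (g := fun l => g (t l))]
        · ring
        · intro l hl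
          rw [Function.update_of_ne]
          have := hnot l hl
          tauto
  refine integral_mono_of_nonneg ?_ (Integrable.fintype_prod wi) ?_
  · filter_upwards [muX_ae k] with t ht
    exact mul_nonneg (hP.nonneg t ht) (hdbl t ht).1
  · filter_upwards [muX_ae k] with t ht
    refine (mul_le_mul (hP.le t ht) (hdbl t ht).2 (hdbl t ht).1
      (Finset.prod_nonneg fun l _ => hg.nonneg _ (ht l).le)).trans (le_of_eq ?_)
    rw [← Finset.mul_prod_erase _ _ (Finset.mem_univ i), ← Finset.mul_prod_erase _ _ hmem,
      ← Finset.mul_prod_erase _ (fun l => w l (t l)) (Finset.mem_univ i),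
      ← Finset.mul_prod_erase _ (fun l => w l (t l)) hmem,
      Finset.prod_congr rfl (f := fun l => w l (t l)) (g := fun l => g (t l) ^ 2)]
    · rw [Finset.prod_pow]
      simp only [hw, true_or, or_true, if_true]
      ring
    · intro l hl
      simp only [hw, if_neg (hnot l hl)]

end main

/-- The one-dimensional profile. -/
noncomputable def phiX (U u : ℝ) : ℝ :=
  (1 - Real.smoothTransition (2 * u / U - 1)) *
    ((1 + u) / ((1 + u) ^ 2 + Real.smoothTransition (-u)))

lemma phiX_contDiff (U : ℝ) : ContDiff ℝ (⊤ : ℕ∞) (phiX U) := by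
  unfold phiX
  apply ContDiff.mul
  · exact contDiff_const.sub (Real.smoothTransition.contDiff.comp (by fun_prop))
  · apply ContDiff.div
    · fun_prop
    · exact ContDiff.add (by fun_prop) (Real.smoothTransition.contDiff.comp (by fun_prop))
    · intro u
      by_cases hu : 0 ≤ u
      · have := Real.smoothTransition.nonneg (-u)
        positivity
      · have := Real.smoothTransition.pos_of_pos (show 0 < -u by linarith)
        positivity

lemma phiX_eq {U u : ℝ} (hu : 0 ≤ u) :
    phiX U u = (1 - Real.smoothTransition (2 * u / U - 1)) * (1 / (1 + u)) := by
  unfold phiX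
  rw [Real.smoothTransition.zero_of_nonpos (show -u ≤ 0 by linarith)]
  congr 1
  field_simp
  ring

lemma phiX_nonneg {U u : ℝ} (hu : 0 ≤ u) : 0 ≤ phiX U u := by
  rw [phiX_eq hu]
  have := Real.smoothTransition.le_one (2 * u / U - 1)
  exact mul_nonneg (by linarith) (by positivity)

lemma phiX_le {U u : ℝ} (hu : 0 ≤ u) : phiX U u ≤ 1 / (1 + u) := by
  rw [phiX_eq hu]
  have := Real.smoothTransition.nonneg (2 * u / U - 1)
  exact mul_le_of_le_one_left (by positivity) (by linarith)

lemma phiX_eq_low {U u : ℝ} (hU : 0 < U) (hu : 0 ≤ u) (hu2 : u ≤ U / 2) :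
    phiX U u = 1 / (1 + u) := by
  rw [phiX_eq hu, Real.smoothTransition.zero_of_nonpos]
  · ring
  · rw [sub_nonpos, div_le_one hU]; linarith

lemma phiX_zero {U u : ℝ} (hU : 0 < U) (hu : U ≤ u) : phiX U u = 0 := by
  rw [phiX_eq (by linarith), Real.smoothTransition.one_of_one_le]
  · ring
  · rw [le_sub_iff_add_le, le_div_iff₀ hU]; linarith

lemma nuX_interval {f : ℝ → ℝ} {U : ℝ} (hU : 0 ≤ U) (hf : ∀ u, U ≤ u → f u = 0) :
    ∫ u, f u ∂nuX = ∫ u in (0 : ℝ)..U, f u := by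
  rw [intervalIntegral.integral_of_le hU]
  unfold nuX
  refine setIntegral_eq_of_subset_of_forall_sdiff_eq_zero measurableSet_Ioi
    Set.Ioc_subset_Ioi_self ?_
  intro u hu
  apply hf
  by_contra hc
  exact hu.2 ⟨hu.1, by linarith⟩

lemma nuX_upper {f F q : ℝ → ℝ} {U : ℝ} (hU : 0 ≤ U) (hf : ∀ u, U ≤ u → f u = 0)
    (hfc : Continuous f) (hq : ContinuousOn q (Set.Icc 0 U)) (hle : ∀ u, 0 ≤ u → f u ≤ q u)
    (hF : ∀ u, 0 ≤ u → HasDerivAt F (q u) u) : ∫ u, f u ∂nuX ≤ F U - F 0 := by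
  have hqi : IntervalIntegrable q volume 0 U := by
    apply ContinuousOn.intervalIntegrable
    rwa [Set.uIcc_of_le hU]
  rw [nuX_interval hU hf, ← intervalIntegral.integral_eq_sub_of_hasDerivAt (f := F) (f' := q) _ hqi]
  · exact intervalIntegral.integral_mono_on hU (hfc.intervalIntegrable _ _) hqi
      fun u hu => hle u hu.1
  · intro u hu
    rw [Set.uIcc_of_le hU] at hu
    exact hF u hu.1

lemma nuX_lower {f F q : ℝ → ℝ} {U : ℝ} (hU : 0 ≤ U) (hf : ∀ u, U ≤ u → f u = 0)
    (hfc : Continuous f) (hq : ContinuousOn q (Set.Icc 0 (U / 2)))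
    (hle : ∀ u, 0 ≤ u → u ≤ U / 2 → f u = q u) (hf0 : ∀ u, 0 ≤ u → 0 ≤ f u)
    (hF : ∀ u, 0 ≤ u → HasDerivAt F (q u) u) : F (U / 2) - F 0 ≤ ∫ u, f u ∂nuX := by
  have hU2 : 0 ≤ U / 2 := by linarith
  have hqi : IntervalIntegrable q volume 0 (U / 2) := by
    apply ContinuousOn.intervalIntegrable
    rwa [Set.uIcc_of_le hU2]
  rw [nuX_interval hU hf, ← intervalIntegral.integral_eq_sub_of_hasDerivAt (f := F) (f' := q) _ hqi]
  · rw [← intervalIntegral.integral_add_adjacent_intervals (hfc.intervalIntegrable 0 (U / 2))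
      (hfc.intervalIntegrable (U / 2) U)]
    have h1 : ∫ u in (0 : ℝ)..(U / 2), q u = ∫ u in (0 : ℝ)..(U / 2), f u := by
      refine intervalIntegral.integral_congr fun u hu => ?_
      rw [Set.uIcc_of_le hU2] at hu
      exact (hle u hu.1 hu.2).symm
    have h2 : 0 ≤ ∫ u in (U / 2)..U, f u :=
      intervalIntegral.integral_nonneg (by linarith) fun u hu => hf0 u (hU2.trans hu.1)
    linarith
  · intro u hu
    rw [Set.uIcc_of_le hU2] at hu
    exact hF u hu.1

lemma derX1 (u : ℝ) (hu : 0 ≤ u) : HasDerivAt (fun u => Real.log (1 + u)) (1 / (1 + u)) u := by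
  have := ((hasDerivAt_id u).const_add 1).log (by simp; positivity)
  simpa using this

lemma derX2 (u : ℝ) (hu : 0 ≤ u) :
    HasDerivAt (fun u : ℝ => -(1 / (1 + u))) ((1 / (1 + u)) ^ 2) u := by
  have h : HasDerivAt (fun u : ℝ => -(1 / (1 + u))) (-(-1 / (1 + u) ^ 2)) u := by
    simp only [one_div]
    exact (((hasDerivAt_id u).const_add 1).inv (by simp; positivity)).neg
  exact h.congr_deriv (by field_simp)

lemma derX3 (u : ℝ) (hu : 0 ≤ u) :
    HasDerivAt (fun u : ℝ => Real.log (1 + u) - -(1 / (1 + u))) ((1 / (1 + u)) ^ 2 * u) u := by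
  exact ((derX1 u hu).sub (derX2 u hu)).congr_deriv (by field_simp; ring)

lemma contX1 (R : ℝ) : ContinuousOn (fun u : ℝ => 1 / (1 + u)) (Set.Icc 0 R) := by
  apply ContinuousOn.div continuousOn_const (by fun_prop)
  intro u hu
  have := hu.1
  positivity

lemma phiX_bounds {U : ℝ} (hU : 0 < U) :
    (∫ u, phiX U u ∂nuX ≤ Real.log (1 + U)) ∧ (Real.log (1 + U / 2) ≤ ∫ u, phiX U u ∂nuX) ∧
    (∫ u, phiX U u ^ 2 ∂nuX ≤ 1) ∧ (1 - 1 / (1 + U / 2) ≤ ∫ u, phiX U u ^ 2 ∂nuX) ∧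
    (∫ u, phiX U u ^ 2 * u ∂nuX ≤ Real.log (1 + U) - 1 + 1 / (1 + U)) ∧
    (∫ u, phiX U u ^ 2 * u ^ 2 ∂nuX ≤ U) := by
  have hc := (phiX_contDiff U).continuous
  refine ⟨?_, ?_, ?_, ?_, ?_, ?_⟩
  · have := nuX_upper (f := phiX U) hU.le (fun u => phiX_zero hU) hc (contX1 U)
      (fun u => phiX_le) derX1
    simpa using this
  · have := nuX_lower (f := phiX U) hU.le (fun u => phiX_zero hU) hc (contX1 _)
      (fun u => phiX_eq_low hU) (fun u => phiX_nonneg) derX1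
    simpa using this
  · have := nuX_upper (f := fun u => phiX U u ^ 2) hU.le (fun u hu => by simp [phiX_zero hU hu])
      (hc.pow 2) ((contX1 U).pow 2)
      (fun u hu => pow_le_pow_left₀ (phiX_nonneg hu) (phiX_le hu) 2) derX2
    have h2 : 0 < (1 + U)⁻¹ := by positivity
    norm_num at this ⊢
    linarith
  · have := nuX_lower (f := fun u => phiX U u ^ 2) hU.le (fun u hu => by simp [phiX_zero hU hu])
      (hc.pow 2) ((contX1 _).pow 2)
      (fun u hu hu2 => by simp [phiX_eq_low hU hu hu2]) (fun u hu => sq_nonneg _) derX2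
    norm_num at this ⊢
    linarith
  · have := nuX_upper (f := fun u => phiX U u ^ 2 * u) hU.le
      (fun u hu => by simp [phiX_zero hU hu])
      ((hc.pow 2).mul continuous_id) (((contX1 U).pow 2).mul continuousOn_id)
      (fun u hu => mul_le_mul_of_nonneg_right
        (pow_le_pow_left₀ (phiX_nonneg hu) (phiX_le hu) 2) hu) derX3
    norm_num at this ⊢
    linarith
  · have := nuX_upper (f := fun u => phiX U u ^ 2 * u ^ 2) (q := fun _ => 1) (F := fun u => u)
      hU.le (fun u hu => by simp [phiX_zero hU hu])
      ((hc.pow 2).mul (continuous_id.pow 2)) continuousOn_const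
      (fun u hu => by
        rw [← mul_pow]
        refine pow_le_one₀ (mul_nonneg (phiX_nonneg hu) hu) ?_
        calc phiX U u * u ≤ 1 / (1 + u) * u := mul_le_mul_of_nonneg_right (phiX_le hu) hu
          _ ≤ 1 := by rw [div_mul_eq_mul_div, div_le_one (by positivity)]; linarith)
      (fun u _ => hasDerivAt_id u)
    simpa using this

lemma nuX_scale (f : ℝ → ℝ) {A : ℝ} (hA : 0 < A) :
    ∫ t, f (A * t) ∂nuX = (∫ u, f u ∂nuX) / A := by
  unfold nuX
  rw [integral_comp_mul_left_Ioi f 0 hA]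
  simp [div_eq_inv_mul]

lemma bigF_signs (k : ℕ) (F : (Fin k → ℝ) → ℝ) :
    Iint k (fun t => (-1) ^ k * F t) = Iint k F ∧
    (∀ i, Jint k (fun t => (-1) ^ k * F t) i = Jint k F i) ∧
    (∀ i j, Lint k (fun t => (-1) ^ k * F t) i j = Lint k F i j) := by
  have hc : ((-1 : ℝ) ^ k) * (-1) ^ k = 1 := by rw [← mul_pow]; simp
  refine ⟨?_, fun i => ?_, fun i j => ?_⟩
  · unfold Iint
    congr 1; funext t
    linear_combination (F t) ^ 2 * hc
  · unfold Jint
    simp only [integral_const_mul]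
    congr 1; funext t
    linear_combination (F t * ∫ u in Set.Ioi (0:ℝ), F (Function.update t i u)) * hc
  · unfold Lint
    simp only [integral_const_mul]
    congr 1; funext t
    linear_combination (F t * ∫ u in Set.Ioi (0:ℝ), ∫ v in Set.Ioi (0:ℝ),
      F (Function.update (Function.update t i u) j v)) * hc

/-- Numerical bounds on the moments of the profile in terms of `x = √(log k)`. -/
lemma profile_num {x : ℝ} (hx : 20 ≤ x) :
    ∃ U : ℝ, 0 < U ∧ U ≤ Real.exp (x ^ 2) ∧
    ∃ a b c d : ℝ, ∫ u, phiX U u ∂nuX = a ∧ ∫ u, phiX U u ^ 2 ∂nuX = b ∧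
      ∫ u, phiX U u ^ 2 * u ∂nuX = c ∧ ∫ u, phiX U u ^ 2 * u ^ 2 ∂nuX = d ∧
      x ^ 2 - 2 * x ≤ a ∧ a ≤ x ^ 2 ∧ 1 - 1 / x ≤ b ∧ b ≤ 1 ∧ c ≤ b * (x ^ 2 - x) ∧ 0 ≤ c ∧
      d ≤ U := by
  set y := x ^ 2 - x with hy
  have hy0 : 380 ≤ y := by nlinarith
  have hE : 1 + y + y ^ 2 / 2 ≤ Real.exp y := Real.quadratic_le_exp_of_nonneg (by linarith)
  set E := Real.exp y with hEdef
  have hE0 : 0 < E := Real.exp_pos y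
  have hU : 0 < E - 1 := by nlinarith
  obtain ⟨h1, h2, h3, h4, h5, h6⟩ := phiX_bounds hU
  have e1 : Real.log (1 + (E - 1)) = y := by
    rw [show 1 + (E - 1) = E by ring, hEdef, Real.log_exp]
  have e2 : y - 1 ≤ Real.log (1 + (E - 1) / 2) := by
    rw [Real.le_log_iff_exp_le (by linarith), Real.exp_sub]
    have : 2 ≤ Real.exp 1 := by linarith [Real.add_one_le_exp 1]
    calc E / Real.exp 1 ≤ E / 2 := by gcongr
      _ ≤ _ := by linarith
  have e3 : 1 / (1 + (E - 1) / 2) ≤ 2 / E := by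
    rw [div_le_div_iff₀ (by linarith) hE0]; linarith
  have e4 : 2 / E ≤ 1 / x := by
    rw [div_le_div_iff₀ hE0 (by linarith)]; nlinarith
  rw [e1] at h1 h5
  rw [show 1 + (E - 1) = E by ring] at h5
  refine ⟨E - 1, hU, ?_, _, _, _, _, rfl, rfl, rfl, rfl, ?_, ?_, ?_, h3, ?_, ?_, h6⟩
  · have : E ≤ Real.exp (x ^ 2) := Real.exp_le_exp.2 (by rw [hy]; linarith)
    linarith
  · linarith
  · linarith
  · linarith
  · refine h5.trans ?_
    have : (1 - 2 / E) * y ≤ (∫ u, phiX (E - 1) u ^ 2 ∂nuX) * y :=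
      mul_le_mul_of_nonneg_right (by linarith) (by linarith)
    refine le_trans ?_ this
    have : (1 + 2 * y) / E ≤ 1 := by rw [div_le_one hE0]; nlinarith
    have e5 : (1 + 2 * y) / E = 1 / E + 2 / E * y := by ring
    linarith
  · refine integral_nonneg_of_ae ?_
    filter_upwards [nuX_ae] with u hu
    exact mul_nonneg (sq_nonneg _) hu.le

set_option maxHeartbeats 1000000 in
lemma final_num {x A D K : ℝ} {k : ℕ} (hk : 2 ≤ k) (hx : 20 ≤ x) (hA : 0 < A) (hK : K = k)
    (hD : D = K * x ^ 2 / A) {a b η v I J L : ℝ}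
    (ha1 : x ^ 2 - 2 * x ≤ a) (ha2 : a ≤ x ^ 2) (hb1 : 1 - 1 / x ≤ b) (hb2 : b ≤ 1)
    (hη : η = K * x / (2 * A)) (hv : v ≤ K / A ^ 3)
    (hI1 : I ≤ (b / A) ^ k) (hI2 : (b / A) ^ k - K * (v * (b / A) ^ (k - 1)) / η ^ 2 ≤ I)
    (hJ : (a / A) ^ 2 * (b / A) ^ (k - 1)
      - (K - 1) * (v * ((a / A) ^ 2 * (b / A) ^ (k - 2))) / η ^ 2 ≤ J)
    (hL : L ≤ (a / A) ^ 4 * (b / A) ^ (k - 2)) (hv0 : 0 ≤ v) :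
    0 < I ∧ (1 - 16 / x) * (D * x ^ 2 / K) * I ≤ J ∧
      L ≤ (1 + 16 / x) * (D * x ^ 2 / K) ^ 2 * I := by
  obtain ⟨n, rfl⟩ : ∃ n, k = n + 2 := ⟨k - 2, by omega⟩
  simp only [show n + 2 - 1 = n + 1 by omega, Nat.add_sub_cancel] at *
  have hK0 : 2 ≤ K := by rw [hK]; push_cast; linarith [Nat.cast_nonneg (α := ℝ) n]
  set z := 1 / x with hz
  have hx0 : 0 < x := by linarith
  have hz0 : 0 < z := by positivity
  have hz1 : z ≤ 1 / 20 := by rw [hz]; exact one_div_le_one_div_of_le (by norm_num) hx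
  have hzx : x * z = 1 := by rw [hz]; field_simp
  have hb0 : 1 / 2 ≤ b := by linarith
  have hDK : D * x ^ 2 / K = x ^ 4 / A := by rw [hD]; field_simp
  have h16 : 16 / x = 16 * z := by rw [hz]; ring
  rw [hDK, h16]
  set B := b / A with hB
  have hB0 : 0 < B := by positivity
  -- the error term
  have herr : K * v / η ^ 2 ≤ z * B := by
    have h1 : K * v / η ^ 2 ≤ K * (K / A ^ 3) / η ^ 2 := by gcongr
    refine h1.trans ?_
    have h2 : K * (K / A ^ 3) / η ^ 2 = 4 * z ^ 2 / A := by
      rw [hη, hz]; field_simp; norm_num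
    rw [h2, hB, ← mul_div_assoc]
    apply div_le_div_of_nonneg_right _ hA.le
    have := mul_nonneg hz0.le (show 0 ≤ b - 4 * z by linarith)
    linarith
  have hη0 : 0 < η ^ 2 := by rw [hη]; positivity
  have hI3 : B ^ (n + 2) * (1 - z) ≤ I := by
    have : K * (v * B ^ (n + 1)) / η ^ 2 = (K * v / η ^ 2) * B ^ (n + 1) := by ring
    rw [this] at hI2
    have h2 : (K * v / η ^ 2) * B ^ (n + 1) ≤ z * B * B ^ (n + 1) := by gcongr
    have h3 : z * B * B ^ (n + 1) = z * B ^ (n + 2) := by ring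
    linarith
  have hIpos : 0 < I := lt_of_lt_of_le (mul_pos (by positivity) (by linarith)) hI3
  refine ⟨hIpos, ?_, ?_⟩
  · have hJ2 : (a / A) ^ 2 * B ^ (n + 1) * (1 - z) ≤ J := by
      have : (K - 1) * (v * ((a / A) ^ 2 * B ^ n)) / η ^ 2
          ≤ K * (v * ((a / A) ^ 2 * B ^ n)) / η ^ 2 := by gcongr; linarith
      have h1 : K * (v * ((a / A) ^ 2 * B ^ n)) / η ^ 2
        = (K * v / η ^ 2) * ((a / A) ^ 2 * B ^ n) := by ring
      have h2 : (K * v / η ^ 2) * ((a / A) ^ 2 * B ^ n) ≤ z * B * ((a / A) ^ 2 * B ^ n) := by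
        gcongr
      have h3 : z * B * ((a / A) ^ 2 * B ^ n) = z * ((a / A) ^ 2 * B ^ (n + 1)) := by ring
      linarith
    refine le_trans ?_ hJ2
    have hc : 0 ≤ (1 - 16 * z) * (x ^ 4 / A) := mul_nonneg (by linarith) (by positivity)
    refine (mul_le_mul_of_nonneg_left hI1 hc).trans ?_
    have key : (1 - 16 * z) * x ^ 4 * b ≤ a ^ 2 * (1 - z) := by
      have h1 : x ^ 2 * (1 - 2 * z) = x ^ 2 - 2 * x := by linear_combination (-2 * x) * hzx
      have h2 : (x ^ 2 * (1 - 2 * z)) ^ 2 ≤ a ^ 2 :=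
        pow_le_pow_left₀ (mul_nonneg (by positivity) (by linarith)) (by linarith) 2
      calc (1 - 16 * z) * x ^ 4 * b ≤ (1 - 16 * z) * x ^ 4 * 1 :=
            mul_le_mul_of_nonneg_left hb2 (mul_nonneg (by linarith) (by positivity))
        _ = x ^ 4 * (1 - 16 * z) := by ring
        _ ≤ x ^ 4 * ((1 - 2 * z) ^ 2 * (1 - z)) := by
            apply mul_le_mul_of_nonneg_left _ (by positivity)
            nlinarith [mul_pos hz0 hz0, mul_pos (mul_pos hz0 hz0) hz0]
        _ = (x ^ 2 * (1 - 2 * z)) ^ 2 * (1 - z) := by ring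
        _ ≤ _ := mul_le_mul_of_nonneg_right h2 (by linarith)
    have e1 : (1 - 16 * z) * (x ^ 4 / A) * B ^ (n + 2)
        = ((1 - 16 * z) * x ^ 4 * b) * (B ^ (n + 1) / A ^ 2) := by
      rw [show B ^ (n + 2) = B ^ (n + 1) * (b / A) by rw [← hB]; ring]
      field_simp
    have e2 : (a / A) ^ 2 * B ^ (n + 1) * (1 - z)
        = (a ^ 2 * (1 - z)) * (B ^ (n + 1) / A ^ 2) := by
      field_simp
    rw [e1, e2]
    exact mul_le_mul_of_nonneg_right key (by positivity)
  · refine hL.trans ?_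
    have hc : 0 ≤ (1 + 16 * z) * (x ^ 4 / A) ^ 2 := by positivity
    refine le_trans ?_ (mul_le_mul_of_nonneg_left hI3 hc)
    have ha0 : 0 ≤ a := le_trans (by nlinarith) ha1
    have key : a ^ 4 ≤ (1 + 16 * z) * x ^ 8 * (b ^ 2 * (1 - z)) := by
      have h1 : a ^ 4 ≤ (x ^ 2) ^ 4 := pow_le_pow_left₀ ha0 ha2 4
      have h2 : (1 - z) ^ 2 ≤ b ^ 2 := pow_le_pow_left₀ (by linarith) hb1 2
      have h3 : (1 - z) ^ 2 * (1 - z) ≤ b ^ 2 * (1 - z) :=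
        mul_le_mul_of_nonneg_right h2 (by linarith)
      have h4 : 1 ≤ (1 + 16 * z) * ((1 - z) ^ 2 * (1 - z)) := by
        have : 1 - 3 * z ≤ (1 - z) ^ 2 * (1 - z) := by
          nlinarith [mul_pos hz0 hz0, mul_pos (mul_pos hz0 hz0) hz0]
        have h5 := mul_le_mul_of_nonneg_left this (show 0 ≤ 1 + 16 * z by positivity)
        nlinarith
      have h6 : 1 ≤ (1 + 16 * z) * (b ^ 2 * (1 - z)) :=
        h4.trans (mul_le_mul_of_nonneg_left h3 (by positivity))
      have h7 := mul_le_mul_of_nonneg_left h6 (show 0 ≤ x ^ 8 by positivity)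
      calc a ^ 4 ≤ x ^ 8 * 1 := by linarith [show (x ^ 2) ^ 4 = x ^ 8 by ring]
        _ ≤ _ := h7
        _ = _ := by ring
    have e1 : (1 + 16 * z) * (x ^ 4 / A) ^ 2 * (B ^ (n + 2) * (1 - z))
        = ((1 + 16 * z) * x ^ 8 * (b ^ 2 * (1 - z))) * (B ^ n / A ^ 4) := by
      rw [show B ^ (n + 2) = B ^ n * (b / A) ^ 2 by rw [← hB]; ring]
      field_simp
    have e2 : (a / A) ^ 4 * B ^ n = a ^ 4 * (B ^ n / A ^ 4) := by field_simp
    rw [e1, e2]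
    exact mul_le_mul_of_nonneg_right key (by positivity)

set_option maxHeartbeats 1000000 in
theorem stmt_15 :
    ∃ C : ℝ, 0 < C ∧ ∃ k₀ : ℕ, 2 ≤ k₀ ∧
    ∀ δ : ℝ, 0 < δ → ∀ ρ : ℝ, 0 < ρ → ρ < 1 → ∀ k : ℕ, k₀ ≤ k → ∀ _hk2 : 2 ≤ k,
    ∃ J : ℕ, 1 ≤ J ∧ ∃ Fml : Fin k → Fin J → ℝ → ℝ,
      (∀ ℓ j, ContDiff ℝ (⊤ : ℕ∞) (Fml ℓ j) ∧ HasCompactSupport (Fml ℓ j)) ∧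
      (∀ ℓ j t, 0 ≤ t → 0 ≤ Fml ℓ j t) ∧
      (∀ ℓ j, ∃ t, 0 ≤ t ∧ Fml ℓ j t ≠ 0) ∧
      (∀ j : Fin J, ∀ t : Fin k → ℝ, (∀ ℓ, 0 ≤ t ℓ) →
        (∏ ℓ, Fml ℓ j (t ℓ)) ≠ 0 → ∑ ℓ, t ℓ ≤ δ) ∧
      (∀ (t : Fin k → ℝ) (σ : Equiv.Perm (Fin k)),
        bigF k J Fml (t ∘ σ) = bigF k J Fml t) ∧
      0 < Iint k (bigF k J Fml) ∧
      (1 - C / Real.sqrt (Real.log k)) * (ρ * δ * Real.log k / k)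
          * Iint k (bigF k J Fml)
        ≤ Jint k (bigF k J Fml) ⟨k - 1, by omega⟩ ∧
      Lint k (bigF k J Fml) ⟨k - 2, by omega⟩ ⟨k - 1, by omega⟩
        ≤ (1 + C / Real.sqrt (Real.log k)) * (ρ * δ * Real.log k / k) ^ 2
          * Iint k (bigF k J Fml) := by
  refine ⟨16, by norm_num, max 2 ⌈Real.exp 400⌉₊, le_max_left _ _, ?_⟩
  intro δ hδ ρ hρ0 hρ1 k hk hk2
  have hkexp : Real.exp 400 ≤ k :=
    (Nat.le_ceil _).trans (by exact_mod_cast (le_max_right _ _).trans hk)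
  have hk0 : (0 : ℝ) < k := lt_of_lt_of_le (Real.exp_pos _) hkexp
  have hlog : 400 ≤ Real.log k := (Real.le_log_iff_exp_le hk0).2 hkexp
  set x := Real.sqrt (Real.log k) with hxdef
  have hx2 : x ^ 2 = Real.log k := Real.sq_sqrt (by linarith)
  have hx : 20 ≤ x := Real.le_sqrt_of_sq_le (by linarith)
  have hkx : Real.exp (x ^ 2) = k := by rw [hx2, Real.exp_log hk0]
  rw [← hx2]
  set D := ρ * δ with hD
  have hD0 : 0 < D := mul_pos hρ0 hδ
  have hDδ : D < δ := by rw [hD]; nlinarith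
  obtain ⟨U, hU, hUk, a, b, c, d, ha, hb, hc, hd, ha1, ha2, hb1, hb2, hcb, hc0, hdU⟩ :=
    profile_num hx
  rw [hkx] at hUk
  set A := (k : ℝ) * x ^ 2 / D with hA
  have hA0 : 0 < A := by positivity
  have hDA : D = k * x ^ 2 / A := by rw [hA]; field_simp
  set g : ℝ → ℝ := fun t => phiX U (A * t) with hgdef
  have hgs : ContDiff ℝ (⊤ : ℕ∞) g := (phiX_contDiff U).comp (by fun_prop)
  have hg : WX g (U / A) := by
    refine ⟨hgs.continuous, fun t ht => phiX_nonneg (by positivity), fun t ht => ?_⟩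
    apply phiX_zero hU
    rw [div_le_iff₀ hA0] at ht
    linarith
  have hb0 : 0 < b := by
    have : 1 / x ≤ 1 / 20 := one_div_le_one_div_of_le (by norm_num) hx
    linarith
  set m := c / (b * A) with hm
  have ga : ∫ t, g t ∂nuX = a / A := by rw [← ha]; exact nuX_scale (phiX U) hA0
  have gb : ∫ t, g t ^ 2 ∂nuX = b / A := by
    rw [← hb]; exact nuX_scale (fun u => phiX U u ^ 2) hA0
  have gc : ∫ t, g t ^ 2 * t ∂nuX = c / A ^ 2 := by
    have := nuX_scale (fun u => phiX U u ^ 2 * u) hA0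
    rw [hc] at this
    have e : (fun t => g t ^ 2 * t) = fun t => (phiX U (A * t) ^ 2 * (A * t)) / A := by
      funext t; simp only [hgdef]; field_simp
    rw [e, integral_div, this]
    field_simp
  have gd : ∫ t, g t ^ 2 * t ^ 2 ∂nuX = d / A ^ 3 := by
    have := nuX_scale (fun u => phiX U u ^ 2 * u ^ 2) hA0
    rw [hd] at this
    have e : (fun t => g t ^ 2 * t ^ 2)
        = fun t => (phiX U (A * t) ^ 2 * (A * t) ^ 2) / A ^ 2 := by
      funext t; simp only [hgdef]; field_simp
    rw [e, integral_div, this]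
    field_simp
  have i0 := hg.int_g2
  have i1 := hg.int_g2f (f := fun t => t) (by fun_prop)
  have i2 := hg.int_g2f (f := fun t => t ^ 2) (by fun_prop)
  have gm : ∫ t, g t ^ 2 * (t - m) ∂nuX = 0 := by
    have e : (fun t => g t ^ 2 * (t - m)) = fun t => g t ^ 2 * t - m * g t ^ 2 := by
      funext t; ring
    rw [e, integral_sub i1 (i0.const_mul m), integral_const_mul, gb, gc, hm]
    field_simp
    ring
  have gv : ∫ t, g t ^ 2 * (t - m) ^ 2 ∂nuX ≤ k / A ^ 3 := by
    have e : (fun t => g t ^ 2 * (t - m) ^ 2)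
        = fun t => g t ^ 2 * t ^ 2 - (2 * m) * (g t ^ 2 * t) + m ^ 2 * g t ^ 2 := by
      funext t; ring
    have i12 : Integrable (fun t => g t ^ 2 * t ^ 2 - (2 * m) * (g t ^ 2 * t)) nuX :=
      i2.sub (i1.const_mul _)
    rw [e, integral_add i12 (i0.const_mul _),
      integral_sub i2 (i1.const_mul _), integral_const_mul, integral_const_mul, gb, gc, gd]
    have e2 : d / A ^ 3 - 2 * m * (c / A ^ 2) + m ^ 2 * (b / A)
        = d / A ^ 3 - c ^ 2 / (b * A ^ 3) := by
      rw [hm]; field_simp; ring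
    rw [e2]
    have h1 : d / A ^ 3 ≤ k / A ^ 3 := by gcongr; linarith
    have h2 : 0 ≤ c ^ 2 / (b * A ^ 3) := by positivity
    linarith
  have gv0 : 0 ≤ ∫ t, g t ^ 2 * (t - m) ^ 2 ∂nuX :=
    integral_nonneg fun t => by positivity
  obtain ⟨J, Fml, q1, q2, q3, q4, q5, q6, q7, q8, q9⟩ := lemmaA hgs hg.nonneg hDδ k (by omega)
  set P : (Fin k → ℝ) → ℝ := fun t => (-1) ^ k * bigF k J Fml t with hPdef
  have hP : PX g D P := ⟨continuous_const.mul q6, q7, q8, q9⟩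
  obtain ⟨sI, sJ, sL⟩ := bigF_signs k (bigF k J Fml)
  have hη0 : 0 < k * x / (2 * A) := by positivity
  have hm0 : 0 ≤ m := by positivity
  have hkm : k * m ≤ k * (x ^ 2 - x) / A := by
    rw [hm, ← mul_div_assoc, div_le_div_iff₀ (by positivity) hA0]
    have := mul_le_mul_of_nonneg_left hcb (show 0 ≤ k * A by positivity)
    linarith
  have hη1 : k * x / (2 * A) ≤ D - U / A - k * m := by
    have h1 : U / A ≤ k * x / (2 * A) := by
      rw [div_le_div_iff₀ hA0 (by positivity)]
      have h3 : U * 2 ≤ k * x := by nlinarith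
      have := mul_le_mul_of_nonneg_right h3 hA0.le
      linarith
    have h2 : k * (x ^ 2 - x) / A = D - k * x / (2 * A) - k * x / (2 * A) := by
      rw [hDA]; field_simp; ring
    linarith
  have hUA : 0 < U / A := by positivity
  have r1 := I_upper hg hP
  have r2 := I_lower hg hP gb gm rfl hη0 (by linarith)
  have r3 := J_lower hg hP ⟨k - 1, by omega⟩ ga gb gm rfl hη0 (by linarith)
  have r4 := L_upper hg hP ⟨k - 2, by omega⟩ ⟨k - 1, by omega⟩
    (by simp only [ne_eq, Fin.mk.injEq]; omega) ga gb
  rw [gb] at r1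
  rw [sI] at r1 r2
  rw [sJ] at r3
  rw [sL] at r4
  obtain ⟨f1, f2, f3⟩ := final_num hk2 hx hA0 rfl hDA ha1 ha2 hb1 hb2 rfl gv r1 r2 r3 r4 gv0
  refine ⟨J, ?_, Fml, q1, q2, q3, q4, q5, f1, f2, f3⟩
  by_contra hJ
  have hJ0 : J = 0 := by omega
  subst hJ0
  have : Iint k (bigF k 0 Fml) = 0 := by
    simp [Iint, bigF]
  linarith
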